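/- Let G be a simple graph on n vertices with matching number β, and let ρ(G) denote the largest eigenvalue of its adjacency matrix. If 2β + 2 ≤ n < 3β + 2, then ρ(G) ≤ 2β, with equality if and only if G is isomorphic to the disjoint union K_{2β+1} ∪ K̄_{n−2β−1}. -/

import Mathlib

open scoped Classical

/-- The adjacency matrix of a graph, over ℝ. -/
noncomputable def adjMat {V : Type*} [Fintype V] (G : SimpleGraph V) : Matrix V V ℝ :=
  fun i j => if G.Adj i j then 1 else 0

/-- The diagonal matrix of vertex degrees, over ℝ. -/
noncomputable def degMat {V : Type*} [Fintype V] (G : SimpleGraph V) : Matrix V V ℝ :=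
  fun i j => if i = j then ((G.neighborSet i).ncard : ℝ) else 0

/-- The largest (real) eigenvalue of a matrix. -/
noncomputable def specRad {V : Type*} [Fintype V] (M : Matrix V V ℝ) : ℝ :=
  sSup {t : ℝ | ∃ v : V → ℝ, v ≠ 0 ∧ M.mulVec v = t • v}

/-- The α-spectral radius: the largest eigenvalue of A_α(G) = α·D(G) + A(G). -/
noncomputable def alphaRadius {V : Type*} [Fintype V] (α : ℝ) (G : SimpleGraph V) : ℝ :=
  specRad (α • degMat G + adjMat G)

/-- The matching number of a graph. -/
noncomputable def matchingNumber {V : Type*} [Fintype V] (G : SimpleGraph V) : ℕ :=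
  sSup {m : ℕ | ∃ M : G.Subgraph, M.IsMatching ∧ M.edgeSet.ncard = m}

/-- The join of two graphs. -/
def graphJoin {A B : Type*} (G : SimpleGraph A) (H : SimpleGraph B) : SimpleGraph (A ⊕ B) :=
  SimpleGraph.fromRel (fun x y => match x, y with
    | Sum.inl a, Sum.inl b => G.Adj a b
    | Sum.inr a, Sum.inr b => H.Adj a b
    | _, _ => True)

/-- The disjoint union of two graphs. -/
def graphSum {A B : Type*} (G : SimpleGraph A) (H : SimpleGraph B) : SimpleGraph (A ⊕ B) :=
  SimpleGraph.fromRel (fun x y => match x, y with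
    | Sum.inl a, Sum.inl b => G.Adj a b
    | Sum.inr a, Sum.inr b => H.Adj a b
    | _, _ => False)

/-- The number of odd components of G − S. -/
noncomputable def oddComponentsOutside {V : Type*} [Fintype V] (G : SimpleGraph V) (S : Set V) : ℕ :=
  Set.ncard {c : (G.induce Sᶜ).ConnectedComponent | Odd c.supp.ncard}

/-- The disjoint union of cliques K_{f 0} ∪ ⋯ ∪ K_{f (q-1)}. -/
def cliquesUnion (q : ℕ) (f : Fin q → ℕ) : SimpleGraph (Σ i : Fin q, Fin (f i)) :=
  SimpleGraph.fromRel (fun x y => x.1 = y.1)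

section Berge

open Finset

/-- A matching covers at most twice as many vertices as it has edges. -/
lemma SimpleGraph.Subgraph.IsMatching.ncard_verts_le {V : Type*} [Fintype V] {G : SimpleGraph V}
    {M : G.Subgraph} (hM : M.IsMatching) : M.verts.ncard ≤ 2 * M.edgeSet.ncard := by
  have h := M.spanningCoe.sum_degrees_eq_twice_card_edges
  have he : #M.spanningCoe.edgeFinset = M.edgeSet.ncard := by
    rw [← Set.ncard_coe_finset, SimpleGraph.coe_edgeFinset, M.edgeSet_spanningCoe]
  have hle : M.verts.toFinset.card ≤ ∑ v, M.spanningCoe.degree v := by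
    rw [Finset.card_eq_sum_ones]
    refine (Finset.sum_le_sum fun v hv => ?_).trans
      (Finset.sum_le_sum_of_subset (Finset.subset_univ _))
    obtain ⟨w, hw, -⟩ := hM (Set.mem_toFinset.1 hv)
    exact (SimpleGraph.degree_pos_iff_exists_adj _ _).2 ⟨w, hw⟩
  rw [Set.ncard_eq_toFinset_card', ← he, ← h]
  exact hle

lemma SimpleGraph.Subgraph.IsMatching.ncard_edgeSet_le_matchingNumber {V : Type*} [Fintype V]
    {G : SimpleGraph V} {M : G.Subgraph} (hM : M.IsMatching) :
    M.edgeSet.ncard ≤ matchingNumber G := by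
  refine le_csSup ⟨Nat.card (Sym2 V), ?_⟩ ⟨M, hM, rfl⟩
  rintro _ ⟨N, -, rfl⟩
  exact Set.ncard_le_card _

lemma graphJoin_adj_inl {A B : Type*} (G : SimpleGraph A) (H : SimpleGraph B) (a b : A) :
    (graphJoin G H).Adj (Sum.inl a) (Sum.inl b) ↔ G.Adj a b := by
  simp only [graphJoin, SimpleGraph.fromRel_adj, ne_eq, Sum.inl.injEq, G.adj_comm b a, or_self]
  exact ⟨fun h => h.2, fun h => ⟨h.ne, h⟩⟩

lemma graphJoin_top_adj_inr {A B : Type*} (G : SimpleGraph A) (b : B) (x : A ⊕ B)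
    (hx : Sum.inr b ≠ x) : (graphJoin G ⊤).Adj (Sum.inr b) x := by
  rw [graphJoin, SimpleGraph.fromRel_adj]
  refine ⟨hx, ?_⟩
  rcases x with a | c
  · simp
  · exact Or.inl fun h => hx (congrArg Sum.inr h)

/-- Adding fewer universal vertices than the deficiency `|V| - 2 * β` does not create a perfect matching. -/
lemma graphJoin_top_not_isPerfectMatching {V : Type*} [Fintype V] (G : SimpleGraph V) (k : ℕ)
    (hk : 2 * matchingNumber G + k < Fintype.card V)
    (M : (graphJoin G (⊤ : SimpleGraph (Fin k))).Subgraph) : ¬ M.IsPerfectMatching := by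
  intro hM
  let N : G.Subgraph :=
    { verts := {v | ∃ w, M.Adj (Sum.inl v) (Sum.inl w)}
      Adj := fun v w => M.Adj (Sum.inl v) (Sum.inl w)
      adj_sub := fun h => (graphJoin_adj_inl G _ _ _).1 h.adj_sub
      edge_vert := fun h => ⟨_, h⟩
      symm := ⟨fun _ _ h => h.symm⟩ }
  have hN : N.IsMatching := by
    rintro v ⟨w, hw⟩
    exact ⟨w, hw, fun u hu => Sum.inl_injective (hM.1.eq_of_adj_left hu hw)⟩
  have h1 := hN.ncard_verts_le
  have h2 := hN.ncard_edgeSet_le_matchingNumber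
  have h3 : N.vertsᶜ.ncard ≤ k := by
    have hp : ∀ v : (N.vertsᶜ : Set V), ∃ a : Fin k, M.Adj (Sum.inl v.1) (Sum.inr a) := by
      rintro ⟨v, hv⟩
      obtain ⟨w, hw, -⟩ := hM.1 (hM.2 (Sum.inl v))
      rcases w with w | a
      · exact absurd ⟨w, hw⟩ hv
      · exact ⟨a, hw⟩
    choose f hf using hp
    have hinj : Function.Injective f := by
      intro u v huv
      have hu := hf u
      rw [huv] at hu
      exact Subtype.ext (Sum.inl_injective (hM.1.eq_of_adj_right hu (hf v)))
    have := Nat.card_le_card_of_injective f hinj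
    rwa [Nat.card_coe_set_eq, Nat.card_fin] at this
  have h4 := Set.ncard_add_ncard_compl N.verts
  rw [Nat.card_eq_fintype_card] at h4
  omega

/-- The nontrivial half of the Tutte–Berge formula, with the components of `G - S` recorded by
a labelling that is constant along the edges of `G - S`. -/
theorem exists_labelling_of_matchingNumber {V : Type} [Fintype V] (G : SimpleGraph V)
    (h : 2 * matchingNumber G + 2 ≤ Fintype.card V) :
    ∃ (S : Finset V) (L : Type) (l : V → L),
      (∀ u v, u ∉ S → v ∉ S → G.Adj u v → l u = l v) ∧
        Fintype.card V + #S ≤ 2 * matchingNumber G + #(Sᶜ.image l) := by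
  obtain ⟨k, hk⟩ := Nat.exists_eq_add_of_le h
  set G' := graphJoin G (⊤ : SimpleGraph (Fin k)) with hG'
  have hT : ¬ ∃ M : G'.Subgraph, M.IsPerfectMatching := by
    rintro ⟨M, hM⟩
    exact graphJoin_top_not_isPerfectMatching G k (by omega) M hM
  rw [SimpleGraph.tutte] at hT
  push Not at hT
  obtain ⟨T, hT⟩ := hT
  rw [SimpleGraph.IsTutteViolator] at hT
  set H := ((⊤ : G'.Subgraph).deleteVerts T) with hH
  have hHv : H.verts.ncard + T.ncard = Fintype.card V + k := by
    have : H.verts = Tᶜ := by ext; simp [hH]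
    rw [this, add_comm, Set.ncard_add_ncard_compl]
    simp
  have hpar := H.coe.odd_ncard_oddComponents
  rw [Nat.card_coe_set_eq] at hpar
  have hT2 : T.ncard + 2 ≤ H.coe.oddComponents.ncard := by
    by_contra hlt
    have : H.coe.oddComponents.ncard = T.ncard + 1 := by omega
    rw [this] at hpar
    grind
  have hadj : ∀ x y : H.verts, H.coe.Adj x y ↔ G'.Adj x.1 y.1 := by
    rintro ⟨x, hx⟩ ⟨y, hy⟩
    simp only [SimpleGraph.Subgraph.coe_adj, hH, SimpleGraph.Subgraph.deleteVerts_adj]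
    simp [hH] at hx hy
    simp [hx, hy]
  have hmem : ∀ x, x ∈ H.verts ↔ x ∉ T := by simp [hH]
  have huniv : ∀ a : Fin k, Sum.inr a ∈ T := by
    intro a
    by_contra ha
    have hconn : ∀ c : H.coe.ConnectedComponent,
        c = H.coe.connectedComponentMk ⟨Sum.inr a, (hmem _).2 ha⟩ := by
      intro c
      induction c using SimpleGraph.ConnectedComponent.ind with
      | h x =>
        by_cases hx : Sum.inr a = x.1
        · congr 1
          exact Subtype.ext hx.symm
        · refine (SimpleGraph.ConnectedComponent.connectedComponentMk_eq_of_adj ?_).symm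
          rw [hadj]
          exact graphJoin_top_adj_inr G a _ hx
    have : H.coe.oddComponents.ncard ≤ 1 :=
      (Set.ncard_le_one (Set.toFinite _)).2 fun _ _ _ _ => (hconn _).trans (hconn _).symm
    omega
  let l : V → Option H.coe.ConnectedComponent := fun v =>
    if hv : Sum.inl v ∈ T then none else
      some (H.coe.connectedComponentMk ⟨Sum.inl v, (hmem _).2 hv⟩)
  refine ⟨univ.filter fun v => Sum.inl v ∈ T, _, l, ?_, ?_⟩
  · intro u v hu hv huv
    simp only [mem_filter, mem_univ, true_and] at hu hv
    simp only [l, hu, hv, dif_neg, not_false_eq_true, Option.some.injEq]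
    refine SimpleGraph.ConnectedComponent.connectedComponentMk_eq_of_adj ?_
    rw [hadj]
    exact (graphJoin_adj_inl G _ _ _).2 huv
  · have hTc : T.ncard = #(univ.filter fun v => Sum.inl v ∈ T) + k := by
      rw [Set.ncard_eq_toFinset_card', ← Finset.card_toLeft_add_card_toRight]
      congr 1
      · congr 1
        ext; simp
      · rw [show T.toFinset.toRight = univ by ext; simp [huniv]]
        simp
    have hcomp : H.coe.oddComponents.ncard ≤
        (l '' ((univ.filter fun v => Sum.inl v ∈ T)ᶜ : Finset V)).ncard := by
      rw [← Set.ncard_image_of_injective _ (Option.some_injective _)]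
      refine Set.ncard_le_ncard ?_ (Set.toFinite _)
      rintro _ ⟨c, -, rfl⟩
      induction c using SimpleGraph.ConnectedComponent.ind with
      | h x =>
        obtain ⟨x | a, hx⟩ := x
        · have hx' := (hmem _).1 hx
          exact ⟨x, by simpa using hx', by simp [l, hx']⟩
        · exact absurd (huniv a) ((hmem _).1 hx)
    have himage : ∀ (L : Type) (f : V → L) (s : Finset V), #(s.image f) = (f '' s).ncard :=
      fun L f s => by rw [← coe_image, Set.ncard_coe_finset]
    rw [himage]
    omega

end Berge

section AdjMat

open Finset

variable {V : Type*} [Fintype V] {G : SimpleGraph V}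

lemma adjMat_mulVec_apply (G : SimpleGraph V) (v : V → ℝ) (i : V) :
    (adjMat G).mulVec v i = ∑ j with G.Adj i j, v j := by
  simp [Matrix.mulVec, dotProduct, adjMat, Finset.sum_filter]

/-- If `A y < c • y` entrywise for a positive weight `y`, then all eigenvalues are less than `c`. -/
lemma adjMat_eigenvalue_lt_of_weight {y : V → ℝ} {c : ℝ} (hy : ∀ i, 0 < y i)
    (hc : ∀ i, ∑ j with G.Adj i j, y j < c * y i) {t : ℝ} {v : V → ℝ} (hv : v ≠ 0)
    (ht : (adjMat G).mulVec v = t • v) : t < c := by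
  obtain ⟨k, hk⟩ := Function.ne_iff.1 hv
  have : Nonempty V := ⟨k⟩
  obtain ⟨i, hi⟩ := Finite.exists_max fun j => |v j| / y j
  set M := |v i| / y i with hM
  have hMpos : 0 < M := (div_pos (abs_pos.2 hk) (hy k)).trans_le (hi k)
  have hle : ∀ j, |v j| ≤ M * y j := fun j => (div_le_iff₀ (hy j)).1 (hi j)
  have hvi : |v i| = M * y i := by rw [hM, div_mul_cancel₀ _ (hy i).ne']
  have hti : ∑ j with G.Adj i j, v j = t * v i := by
    rw [← adjMat_mulVec_apply, ht]; rfl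
  have h1 : t * |v i| < c * |v i| :=
    calc t * |v i| ≤ |t| * |v i| := by gcongr; exact le_abs_self t
      _ = |∑ j with G.Adj i j, v j| := by rw [hti, abs_mul]
      _ ≤ ∑ j with G.Adj i j, |v j| := abs_sum_le_sum_abs _ _
      _ ≤ ∑ j with G.Adj i j, M * y j := sum_le_sum fun j _ => hle j
      _ = M * ∑ j with G.Adj i j, y j := (mul_sum _ _ _).symm
      _ < M * (c * y i) := mul_lt_mul_of_pos_left (hc i) hMpos
      _ = c * |v i| := by rw [hvi]; ring
  exact lt_of_mul_lt_mul_right h1 (abs_nonneg _)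

/-- If all degrees are at most `c` then so are the eigenvalues. -/
lemma adjMat_eigenvalue_le_of_degree_le {c : ℕ} (hc : ∀ i, #{j | G.Adj i j} ≤ c) {t : ℝ}
    {v : V → ℝ} (hv : v ≠ 0) (ht : (adjMat G).mulVec v = t • v) : t ≤ c := by
  refine le_of_forall_pos_lt_add fun ε hε => ?_
  refine adjMat_eigenvalue_lt_of_weight (y := fun _ => 1) (fun _ => one_pos) (fun i => ?_) hv ht
  have : (#{j | G.Adj i j} : ℝ) ≤ c := by exact_mod_cast hc i
  simp only [sum_const, nsmul_eq_mul, mul_one]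
  linarith

/-- If all degrees are at most `c` and `c` is an eigenvalue, then a vertex where the eigenvector
has maximal modulus has degree `c`, and the modulus is also maximal at its neighbours. -/
lemma adjMat_eigenvector_max {c : ℕ} (hc : ∀ i, #{j | G.Adj i j} ≤ c)
    {v : V → ℝ} (ht : (adjMat G).mulVec v = (c : ℝ) • v) {i : V} (hi : v i ≠ 0)
    (hmax : ∀ j, |v j| ≤ |v i|) :
    #{j | G.Adj i j} = c ∧ ∀ j, G.Adj i j → |v j| = |v i| := by
  have hti : ∑ j with G.Adj i j, v j = c * v i := by
    rw [← adjMat_mulVec_apply, ht]; rfl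
  have h1 : c * |v i| ≤ ∑ j with G.Adj i j, |v j| := by
    refine le_trans (le_of_eq ?_) (abs_sum_le_sum_abs _ _)
    rw [hti, abs_mul, Nat.abs_cast]
  have h2 : ∑ j with G.Adj i j, |v j| ≤ ∑ j with G.Adj i j, |v i| :=
    sum_le_sum fun j _ => hmax j
  have h3 : ∑ j with G.Adj i j, |v i| = #{j | G.Adj i j} * |v i| := by simp
  have hpos : 0 < |v i| := abs_pos.2 hi
  have h4 : (c : ℝ) ≤ #{j | G.Adj i j} := le_of_mul_le_mul_right (by linarith) hpos
  have h5 : #{j | G.Adj i j} = c := le_antisymm (hc i) (by exact_mod_cast h4)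
  refine ⟨h5, fun j hj => ?_⟩
  rw [h5] at h3
  have h6 := (sum_eq_sum_iff_of_le (s := univ.filter fun j => G.Adj i j)
    (f := fun j => |v j|) (g := fun _ => |v i|) fun j _ => hmax j).1 (by linarith)
  exact h6 j (by simpa using hj)

/-- A nonzero `specRad` is attained by an eigenvector. -/
lemma specRad_mem_of_ne_zero {M : Matrix V V ℝ} (h : specRad M ≠ 0) :
    ∃ v : V → ℝ, v ≠ 0 ∧ M.mulVec v = specRad M • v := by
  have hfin : {t : ℝ | ∃ v : V → ℝ, v ≠ 0 ∧ M.mulVec v = t • v}.Finite := by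
    refine (Module.End.finite_hasEigenvalue (Matrix.toLin' M)).subset ?_
    rintro t ⟨v, hv, ht⟩
    exact Module.End.hasEigenvalue_of_hasEigenvector
      (Module.End.hasEigenvector_iff.2 ⟨Module.End.mem_eigenspace_iff.2 (by simpa using ht), hv⟩)
  refine Set.Nonempty.csSup_mem ?_ hfin
  by_contra hne
  rw [Set.not_nonempty_iff_eq_empty] at hne
  exact h (by rw [specRad, hne, Real.sSup_empty])

end AdjMat

section Labelling

open Finset

variable {V L : Type*}

lemma card_fiber_add_card_image_le (U : Finset V) (l : V → L) (v : V) :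
    #{u ∈ U | l u = l v} + #(U.image l) ≤ #U + 1 := by
  have h1 : U.image l ⊆ insert (l v) ((U.filter fun u => ¬ l u = l v).image l) := by
    intro x hx
    obtain ⟨u, hu, rfl⟩ := mem_image.1 hx
    by_cases h : l u = l v
    · simp [h]
    · exact mem_insert_of_mem (mem_image_of_mem _ (by simp [hu, h]))
  have h2 := (card_le_card h1).trans (card_insert_le _ _)
  have h3 := card_image_le (s := U.filter fun u => ¬ l u = l v) (f := l)
  have h4 := card_filter_add_card_filter_not (s := U) fun u => l u = l v
  omega

/-- A label shared by two vertices outside one fibre costs one more label. -/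
lemma card_fiber_add_card_image_lt {U : Finset V} {l : V → L} {v u w : V} (hu : u ∈ U)
    (hw : w ∈ U) (huw : u ≠ w) (hl : l u = l w) (hv : l u ≠ l v) :
    #{x ∈ U | l x = l v} + #(U.image l) ≤ #U := by
  have h1 : U.image l = (U.erase u).image l := by
    ext x
    simp only [mem_image, mem_erase]
    constructor
    · rintro ⟨y, hy, rfl⟩
      by_cases h : y = u
      · exact ⟨w, ⟨huw.symm, hw⟩, by rw [h, hl]⟩
      · exact ⟨y, ⟨h, hy⟩, rfl⟩
    · rintro ⟨y, ⟨-, hy⟩, rfl⟩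
      exact ⟨y, hy, rfl⟩
  have h2 := card_fiber_add_card_image_le (U.erase u) l v
  have h3 : {x ∈ U.erase u | l x = l v} = {x ∈ U | l x = l v} := by
    ext x
    simp only [mem_filter, mem_erase]
    refine ⟨fun h => ⟨h.1.2, h.2⟩, fun h => ⟨⟨?_, h.1⟩, h.2⟩⟩
    rintro rfl
    exact hv h.2
  have h4 := card_erase_add_one hu
  rw [h3] at h2
  rw [h1]
  omega

lemma sum_inv_card_fiber (U : Finset V) (l : V → L) :
    ∑ v ∈ U, (#{u ∈ U | l u = l v} : ℝ)⁻¹ = #(U.image l) := by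
  rw [sum_comp (fun b => (#{u ∈ U | l u = b} : ℝ)⁻¹) l, card_eq_sum_ones, Nat.cast_sum]
  refine sum_congr rfl fun b hb => ?_
  obtain ⟨u, hu, rfl⟩ := mem_image.1 hb
  have : (#{a ∈ U | l a = l u} : ℝ) ≠ 0 := by
    exact_mod_cast (card_pos.2 ⟨u, by simp [hu]⟩).ne'
  simp [this]

end Labelling

section Main

open Finset

variable {V L : Type*} [Fintype V] {G : SimpleGraph V}

/-- With a nonempty Tutte–Berge set all eigenvalues are less than `2 * b`. -/
theorem adjMat_eigenvalue_lt_of_labelling {b : ℕ} {S : Finset V} {l : V → L}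
    (hS : S.Nonempty) (hl : ∀ u v, u ∉ S → v ∉ S → G.Adj u v → l u = l v)
    (hcard : Fintype.card V + #S ≤ 2 * b + #(Sᶜ.image l))
    (hV : Fintype.card V ≤ 3 * b + 1) {t : ℝ} {v : V → ℝ} (hv : v ≠ 0)
    (ht : (adjMat G).mulVec v = t • v) : t < 2 * b := by
  set m : V → ℕ := fun v => #{u ∈ Sᶜ | l u = l v} with hm
  set q := #(Sᶜ.image l) with hq
  have hcompl : #S + #Sᶜ = Fintype.card V := card_add_card_compl S
  have hq_le : q ≤ #Sᶜ := card_image_le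
  have hSpos : 0 < #S := hS.card_pos
  have hm_le : ∀ v, (m v : ℝ) + 2 * #S ≤ 2 * b + 1 := by
    intro v
    have : m v + q ≤ #Sᶜ + 1 := card_fiber_add_card_image_le Sᶜ l v
    have : m v + 2 * #S ≤ 2 * b + 1 := by omega
    exact_mod_cast this
  have hm_pos : ∀ v ∉ S, (1 : ℝ) ≤ m v := by
    intro v hv
    exact_mod_cast card_pos.2 ⟨v, by simp [hv]⟩
  have hs1 : (1 : ℝ) ≤ #S := by exact_mod_cast hSpos
  have hsb : (#S : ℝ) ≤ b := by
    have : #S ≤ b := by omega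
    exact_mod_cast this
  have hcardR : (#Sᶜ : ℝ) + 2 * #S ≤ 2 * b + q := by
    have : #Sᶜ + 2 * #S ≤ 2 * b + q := by omega
    exact_mod_cast this
  have hVR : (#Sᶜ : ℝ) + #S ≤ 3 * b + 1 := by
    have : #Sᶜ + #S ≤ 3 * b + 1 := by omega
    exact_mod_cast this
  generalize hsR : (#S : ℝ) = s at *
  generalize hbR : (b : ℝ) = c at *
  have hcpos : 0 < c := by linarith
  set K : ℝ := (2 * c + 3) / (2 * c + 2) with hK
  have hK1 : 1 < K := by rw [hK, lt_div_iff₀ (by positivity)]; linarith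
  have hden : ∀ v, 0 < 2 * c + 1 - m v := fun v => by linarith [hm_le v]
  set y : V → ℝ := fun v => if v ∈ S then 1 else K * (s / (2 * c + 1 - m v)) with hy
  have hy_pos : ∀ v, 0 < y v := by
    intro v
    have := hden v
    simp only [hy]
    split_ifs <;> positivity
  have hyS : ∑ j ∈ S, y j = s := by
    rw [sum_congr rfl fun j hj => show y j = 1 by simp [hy, hj]]
    simpa using hsR
  have hySc : ∑ j ∈ Sᶜ, y j < 2 * c + 1 - s := by
    have hle : ∀ j ∈ Sᶜ, y j ≤ K * ((m j : ℝ)⁻¹ * ((2 * s - (2 * c + 1)) / (4 * c))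
        + (2 * c + 1) / (4 * c)) := by
      intro j hj
      have hjS : j ∉ S := by simpa using hj
      have h1 := hm_pos j hjS
      have h2 := hden j
      have h3 := hm_le j
      simp only [hy, hjS, if_false]
      refine mul_le_mul_of_nonneg_left ?_ (by positivity)
      have : (m j : ℝ)⁻¹ * ((2 * s - (2 * c + 1)) / (4 * c)) + (2 * c + 1) / (4 * c)
          = (2 * s + (m j - 1) * (2 * c + 1)) / (m j * (4 * c)) := by
        field_simp
        ring
      rw [this, div_le_div_iff₀ h2 (by positivity)]
      nlinarith [mul_nonneg (mul_nonneg (sub_nonneg.2 h1) (by linarith : 0 ≤ 2 * c + 1))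
        (by linarith : 0 ≤ 2 * c + 1 - m j - 2 * s)]
    refine (sum_le_sum hle).trans_lt ?_
    rw [← mul_sum, sum_add_distrib, ← sum_mul, sum_inv_card_fiber, sum_const, nsmul_eq_mul]
    have hbound : (q : ℝ) * ((2 * s - (2 * c + 1)) / (4 * c)) + #Sᶜ * ((2 * c + 1) / (4 * c))
        ≤ (2 * c + 1) / 2 := by
      have : (q : ℝ) * ((2 * s - (2 * c + 1)) / (4 * c)) + #Sᶜ * ((2 * c + 1) / (4 * c))
          = (q * (2 * s - (2 * c + 1)) + #Sᶜ * (2 * c + 1)) / (4 * c) := by ring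
      rw [this, div_le_div_iff₀ (by positivity) two_pos]
      nlinarith [mul_nonneg (by linarith : 0 ≤ 2 * c + 1 - 2 * s)
        (by linarith : 0 ≤ 2 * c + q - #Sᶜ - 2 * s), mul_nonneg (by linarith : 0 ≤ s)
        (by linarith : 0 ≤ 3 * c + 1 - #Sᶜ - s), mul_nonneg (by linarith : 0 ≤ s)
        (by linarith : 0 ≤ c - s)]
    refine (mul_le_mul_of_nonneg_left hbound (by positivity)).trans_lt ?_
    have : K * ((2 * c + 1) / 2) < c + 1 := by
      rw [hK, div_mul_div_comm, div_lt_iff₀ (by positivity)]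
      nlinarith
    linarith
  refine adjMat_eigenvalue_lt_of_weight hy_pos (fun i => ?_) hv ht
  by_cases hi : i ∈ S
  · have h1 : ∑ j with G.Adj i j, y j ≤ ∑ j ∈ univ.erase i, y j := by
      refine sum_le_sum_of_subset_of_nonneg (fun j hj => ?_) fun j _ _ => (hy_pos j).le
      simp only [mem_filter, mem_univ, true_and] at hj
      simpa using hj.ne'
    have h2 := sum_erase_add univ y (mem_univ i)
    have h3 := sum_add_sum_compl S y
    have h4 : y i = 1 := by simp [hy, hi]
    rw [h4] at h2 ⊢
    linarith
  · have h1 : ∑ j with G.Adj i j, y j ≤ ∑ j ∈ S ∪ {u ∈ Sᶜ | l u = l i}.erase i, y j := by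
      refine sum_le_sum_of_subset_of_nonneg (fun j hj => ?_) fun j _ _ => (hy_pos j).le
      simp only [mem_filter, mem_univ, true_and] at hj
      by_cases hjS : j ∈ S
      · simp [hjS]
      · simp [hjS, hj.ne', hl i j hi hjS hj]
    have h2 : ∑ j ∈ {u ∈ Sᶜ | l u = l i}.erase i, y j = (m i - 1) * y i := by
      have hi' : i ∈ ({u ∈ Sᶜ | l u = l i} : Finset V) := by simp [hi]
      have h4 : ∀ j ∈ ({u ∈ Sᶜ | l u = l i} : Finset V), y j = y i := by
        intro j hj
        simp only [mem_filter, mem_compl] at hj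
        simp only [hy, hm, hj.1, hi, hj.2]
      have h3 := sum_erase_add _ y hi'
      rw [sum_congr rfl h4, sum_const, nsmul_eq_mul] at h3
      linarith
    rw [sum_union (disjoint_left.2 fun j hj => by simp [hj]), hyS, h2] at h1
    have h5 : (2 * c + 1 - m i) * y i = K * s := by
      have := (hden i).ne'
      simp only [hy, hi, if_false]
      field_simp
    nlinarith

/-- With an empty Tutte–Berge set, if `2 * b` is an eigenvalue then the graph is a clique on
`2 * b + 1` vertices together with isolated vertices. -/
theorem exists_adj_iff_of_labelling {b : ℕ} {l : V → L}
    (hl : ∀ u v, G.Adj u v → l u = l v) (hcard : Fintype.card V ≤ 2 * b + #(univ.image l))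
    {v : V → ℝ} (hv : v ≠ 0) (ht : (adjMat G).mulVec v = (2 * b : ℝ) • v) :
    ∃ F : Finset V, #F = 2 * b + 1 ∧ ∀ x y, G.Adj x y ↔ x ≠ y ∧ x ∈ F ∧ y ∈ F := by
  have hsub : ∀ i, ({j | G.Adj i j} : Finset V) ⊆ ({u | l u = l i} : Finset V).erase i := by
    intro i j hj
    simp only [mem_filter, mem_univ, true_and] at hj
    simp [hj.ne', hl i j hj]
  have hfib : ∀ i, #({u | l u = l i} : Finset V) ≤ 2 * b + 1 := by
    intro i
    have := card_fiber_add_card_image_le univ l i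
    rw [card_univ] at this
    omega
  have herase : ∀ i, #(({u | l u = l i} : Finset V).erase i) + 1
      = #({u | l u = l i} : Finset V) := fun i => card_erase_add_one (by simp)
  have hdeg : ∀ i, #({j | G.Adj i j} : Finset V) ≤ 2 * b := by
    intro i
    have h1 := card_le_card (hsub i)
    have h2 := hfib i
    have h3 := herase i
    omega
  obtain ⟨k, hk⟩ := Function.ne_iff.1 hv
  have : Nonempty V := ⟨k⟩
  obtain ⟨i, hi⟩ := Finite.exists_max fun j => |v j|
  have hmaxpos : 0 < |v i| := (abs_pos.2 hk).trans_le (hi k)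
  have hmax : ∀ j, |v j| = |v i| →
      ({x | G.Adj j x} : Finset V) = ({u | l u = l j} : Finset V).erase j ∧
        ∀ x, G.Adj j x → |v x| = |v j| := by
    intro j hj
    obtain ⟨h1, h2⟩ := adjMat_eigenvector_max (c := 2 * b) hdeg (by push_cast; exact ht)
      (abs_pos.1 (hj ▸ hmaxpos)) (fun x => hj ▸ hi x)
    refine ⟨eq_of_subset_of_card_le (hsub j) ?_, h2⟩
    have h3 := hfib j
    have h4 := herase j
    omega
  obtain ⟨hNi, hnb⟩ := hmax i rfl
  have hclique : ∀ x y, l x = l i → (G.Adj x y ↔ x ≠ y ∧ l y = l i) := by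
    intro x y hx
    have hvx : |v x| = |v i| := by
      by_cases hxi : x = i
      · rw [hxi]
      · have : x ∈ ({j | G.Adj i j} : Finset V) := by rw [hNi]; simp [hxi, hx]
        exact hnb x (by simpa using this)
    have h1 := Finset.ext_iff.1 (hmax x hvx).1 y
    simp only [mem_filter, mem_univ, true_and, mem_erase, hx] at h1
    rw [h1, ne_comm]
  have hF : #({u | l u = l i} : Finset V) = 2 * b + 1 := by
    have h1 := (adjMat_eigenvector_max (c := 2 * b) hdeg (by push_cast; exact ht)
      (abs_pos.1 hmaxpos) hi).1
    have h2 := herase i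
    rw [← hNi, h1] at h2
    exact h2.symm
  refine ⟨({u | l u = l i} : Finset V), hF, fun x y => ?_⟩
  simp only [mem_filter, mem_univ, true_and]
  by_cases hx : l x = l i
  · simp [hclique x y hx, hx]
  · refine ⟨fun h => ?_, fun h => absurd h.2.1 hx⟩
    have := card_fiber_add_card_image_lt (mem_univ x) (mem_univ y) h.ne (hl x y h) hx
    rw [hF, card_univ] at this
    omega

lemma graphSum_adj_inl {A B : Type*} (G : SimpleGraph A) (H : SimpleGraph B) (a b : A) :
    (graphSum G H).Adj (Sum.inl a) (Sum.inl b) ↔ G.Adj a b := by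
  simp only [graphSum, SimpleGraph.fromRel_adj, ne_eq, Sum.inl.injEq, G.adj_comm b a, or_self]
  exact ⟨fun h => h.2, fun h => ⟨h.ne, h⟩⟩

lemma graphSum_adj_inr {A B : Type*} (G : SimpleGraph A) (H : SimpleGraph B) (a b : B) :
    (graphSum G H).Adj (Sum.inr a) (Sum.inr b) ↔ H.Adj a b := by
  simp only [graphSum, SimpleGraph.fromRel_adj, ne_eq, Sum.inr.injEq, H.adj_comm b a, or_self]
  exact ⟨fun h => h.2, fun h => ⟨h.ne, h⟩⟩

lemma graphSum_not_adj_inl_inr {A B : Type*} (G : SimpleGraph A) (H : SimpleGraph B) (a : A)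
    (b : B) : ¬ (graphSum G H).Adj (Sum.inl a) (Sum.inr b) := by
  simp [graphSum]

lemma graphSum_not_adj_inr_inl {A B : Type*} (G : SimpleGraph A) (H : SimpleGraph B) (a : A)
    (b : B) : ¬ (graphSum G H).Adj (Sum.inr b) (Sum.inl a) := by
  simp [graphSum]

lemma nonempty_iso_graphSum_top_bot {k m : ℕ} {F : Finset V} (hF : #F = k)
    (hV : Fintype.card V = k + m) (hadj : ∀ x y, G.Adj x y ↔ x ≠ y ∧ x ∈ F ∧ y ∈ F) :
    Nonempty (G ≃g graphSum (⊤ : SimpleGraph (Fin k)) (⊥ : SimpleGraph (Fin m))) := by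
  let e₁ : {x // x ∈ F} ≃ Fin k := Fintype.equivFinOfCardEq (by simpa using hF)
  let e₂ : {x // x ∉ F} ≃ Fin m := Fintype.equivFinOfCardEq (by
    rw [Fintype.card_subtype_compl, Fintype.card_coe]; omega)
  let e : {x // x ∈ F} ⊕ {x // x ∉ F} ≃ V := Equiv.sumCompl (· ∈ F)
  suffices h : ∀ x y, G.Adj (e x) (e y) ↔
      (graphSum (⊤ : SimpleGraph (Fin k)) (⊥ : SimpleGraph (Fin m))).Adj
        (Equiv.sumCongr e₁ e₂ x) (Equiv.sumCongr e₁ e₂ y) by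
    refine ⟨⟨e.symm.trans (Equiv.sumCongr e₁ e₂), ?_⟩⟩
    intro x y
    have := h (e.symm x) (e.symm y)
    simp only [Equiv.apply_symm_apply] at this
    exact this.symm
  rintro (⟨x, hx⟩ | ⟨x, hx⟩) (⟨y, hy⟩ | ⟨y, hy⟩) <;>
    simp [e, hadj, hx, hy, graphSum_adj_inl, graphSum_adj_inr, graphSum_not_adj_inl_inr,
      graphSum_not_adj_inr_inl]

/-- The indicator vector of the clique is an eigenvector. -/
lemma exists_eigenvector_of_iso_graphSum {k m : ℕ}
    (e : G ≃g graphSum (⊤ : SimpleGraph (Fin (k + 1))) (⊥ : SimpleGraph (Fin m))) :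
    ∃ v : V → ℝ, v ≠ 0 ∧ (adjMat G).mulVec v = (k : ℝ) • v := by
  let w : Fin (k + 1) ⊕ Fin m → ℝ := Sum.elim (fun _ => 1) fun _ => 0
  have hw : ∀ x, ∑ z, (if (graphSum (⊤ : SimpleGraph (Fin (k + 1)))
      (⊥ : SimpleGraph (Fin m))).Adj x z then w z else 0) = k * w x := by
    rintro (a | a)
    · rw [Fintype.sum_sum_type]
      simp only [graphSum_adj_inl, graphSum_not_adj_inl_inr, w, Sum.elim_inl, Sum.elim_inr]
      simp [Finset.sum_ite, Finset.filter_ne]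
    · rw [Fintype.sum_sum_type]
      simp [graphSum_adj_inr, graphSum_not_adj_inr_inl, w]
  refine ⟨fun i => w (e i), fun h => ?_, ?_⟩
  · have := congrFun h (e.symm (Sum.inl 0))
    simp [w] at this
  · ext i
    rw [adjMat_mulVec_apply, sum_filter, Pi.smul_apply, smul_eq_mul, ← hw (e i),
      ← Equiv.sum_comp e.toEquiv]
    exact sum_congr rfl fun j _ => by simp [e.map_adj_iff]

end Main

theorem stmt5 (n β : ℕ) (G : SimpleGraph (Fin n))
    (hβ : matchingNumber G = β) (h1 : 2 * β + 2 ≤ n) (h2 : n < 3 * β + 2) :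
    specRad (adjMat G) ≤ 2 * β ∧
      (specRad (adjMat G) = 2 * β ↔
        Nonempty (G ≃g graphSum (⊤ : SimpleGraph (Fin (2 * β + 1)))
          (⊥ : SimpleGraph (Fin (n - (2 * β + 1)))))) := by
  subst hβ
  set b := matchingNumber G
  have hb : 0 < b := by omega
  have hbR : (0 : ℝ) < 2 * b := by positivity
  obtain ⟨S, L, l, hl, hcard⟩ :=
    exists_labelling_of_matchingNumber G (by rwa [Fintype.card_fin])
  have hle : ∀ t : ℝ, (∃ v : Fin n → ℝ, v ≠ 0 ∧ (adjMat G).mulVec v = t • v) → t ≤ 2 * b := by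
    rintro t ⟨v, hv, ht⟩
    rcases S.eq_empty_or_nonempty with rfl | hS
    · have := adjMat_eigenvalue_le_of_degree_le (c := 2 * b) (fun i => ?_) hv ht
      · exact_mod_cast this
      · have h3 := card_fiber_add_card_image_le Finset.univ l i
        have h4 : ({j | G.Adj i j} : Finset (Fin n)) ⊂
            ({u | l u = l i} : Finset (Fin n)) := by
          refine Finset.ssubset_iff_of_subset (fun j hj => ?_) |>.2 ⟨i, by simp, by simp⟩
          simpa using (hl i j (by simp) (by simp) (by simpa using hj)).symm
        have h5 := Finset.card_lt_card h4
        simp only [Finset.compl_empty, Finset.card_empty] at hcard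
        rw [Finset.card_univ] at h3
        omega
    · exact (adjMat_eigenvalue_lt_of_labelling hS hl hcard
        (by rw [Fintype.card_fin]; omega) hv ht).le
  have hrad : specRad (adjMat G) ≤ 2 * b := Real.sSup_le hle hbR.le
  refine ⟨hrad, fun h => ?_, ?_⟩
  · obtain ⟨v, hv, ht⟩ := specRad_mem_of_ne_zero (h ▸ hbR.ne')
    rw [h] at ht
    rcases S.eq_empty_or_nonempty with rfl | hS
    · obtain ⟨F, hF, hadj⟩ := exists_adj_iff_of_labelling
        (fun x y => hl x y (by simp) (by simp)) (by simpa using hcard) hv ht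
      exact nonempty_iso_graphSum_top_bot hF (by rw [Fintype.card_fin]; omega) hadj
    · exact absurd (adjMat_eigenvalue_lt_of_labelling hS hl hcard
        (by rw [Fintype.card_fin]; omega) hv ht) (lt_irrefl _)
  · rintro ⟨e⟩
    obtain ⟨v, hv, ht⟩ := exists_eigenvector_of_iso_graphSum e
    refine le_antisymm hrad (le_csSup ⟨_, fun t ht => hle t ht⟩ ⟨v, hv, ?_⟩)
    rw [ht]
    push_cast
    rfl
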